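/- arXiv:2211.04456 — 5 statements merged into one kernel-verified Lean document; each statement's English description precedes it below -/
import Mathlib

section
/- Let α ∈ [1/2, 1) with β = (2α−1)/(1−α) and let X be an integrable random variable. A real number e satisfies the α-expectile equation α·E[max(X−e,0)] = (1−α)·E[max(e−X,0)] if and only if e is a fixed point of h_{X,α}, i.e. e = E[max((1+β)X − βe, X)]. -/
open MeasureTheory

/-- The α-expectile equation for a real number `e`:
`α·E[max(X−e,0)] = (1−α)·E[max(e−X,0)]`. -/
def ExpectileEq {Ω : Type*} [MeasurableSpace Ω] (P : Measure Ω) (α : ℝ) (X : Ω → ℝ)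
    (e : ℝ) : Prop :=
  α * ∫ ω, max (X ω - e) 0 ∂P = (1 - α) * ∫ ω, max (e - X ω) 0 ∂P

/-- Let `α ∈ [1/2, 1)` with `β = (2α−1)/(1−α)` and let `X` be an
integrable random variable. A real number `e` satisfies the α-expectile equation
`α·E[max(X−e,0)] = (1−α)·E[max(e−X,0)]` if and only if `e` is a fixed point of
`h_{X,α}`, i.e. `e = E[max((1+β)X − βe, X)]`. -/
theorem expectileEq_iff_fixedPoint
    {Ω : Type*} [MeasurableSpace Ω] (P : Measure Ω) [IsProbabilityMeasure P]
    (X : Ω → ℝ) (hX : Integrable X P)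
    (α β : ℝ) (hα : α ∈ Set.Ico (1/2 : ℝ) 1) (hβ : β = (2*α - 1)/(1 - α))
    (e : ℝ) :
    ExpectileEq P α X e ↔ e = ∫ ω, max ((1 + β) * X ω - β * e) (X ω) ∂P := by
  obtain ⟨hα₁, hα₂⟩ := hα
  have hpos : 0 < 1 - α := by linarith
  have hβ_nonneg : 0 ≤ β := hβ ▸ div_nonneg (by linarith) hpos.le
  have hβ_mul : (1 - α) * β = 2 * α - 1 := by
    rw [hβ, mul_div_cancel₀ _ hpos.ne']
  have hgain : Integrable (fun ω => max (X ω - e) 0) P :=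
    (hX.sub (integrable_const e)).pos_part
  have hloss : Integrable (fun ω => max (e - X ω) 0) P :=
    ((integrable_const e).sub hX).pos_part
  have hdiff : ∫ ω, max (X ω - e) 0 ∂P - ∫ ω, max (e - X ω) 0 ∂P = ∫ ω, X ω ∂P - e := by
    have hsplit : ∀ ω, max (X ω - e) 0 - max (e - X ω) 0 = X ω - e := fun ω => by
      rw [← neg_sub (X ω) e, max_zero_sub_max_neg_zero_eq_self]
    rw [← integral_sub hgain hloss, integral_congr_ae (.of_forall hsplit),
      integral_sub hX (integrable_const e)]
    simp
  have hfix : ∫ ω, max ((1 + β) * X ω - β * e) (X ω) ∂P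
      = ∫ ω, X ω ∂P + β * ∫ ω, max (X ω - e) 0 ∂P := by
    have hmax : ∀ ω, max ((1 + β) * X ω - β * e) (X ω) = X ω + β * max (X ω - e) 0 := fun ω => by
      rw [mul_max_of_nonneg _ _ hβ_nonneg, mul_zero, ← max_add_add_left, add_zero]
      ring_nf
    rw [integral_congr_ae (.of_forall hmax), integral_add hX (hgain.const_mul β),
      integral_const_mul]
  rw [ExpectileEq, hfix]
  generalize ∫ ω, max (X ω - e) 0 ∂P = a at *
  constructor
  · intro h
    refine mul_left_cancel₀ hpos.ne' ?_
    linear_combination -h + (1 - α) * hdiff - a * hβ_mul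
  · intro h
    linear_combination -(1 - α) * h + (1 - α) * hdiff - a * hβ_mul
end

section
/- For every level α ∈ (0,1) and every integrable random variable X, there exists exactly one real number e satisfying the α-expectile equation α·E[max(X−e,0)] = (1−α)·E[max(e−X,0)]. -/
open MeasureTheory

/-- A continuous real function that decreases at least linearly has exactly one zero. -/
theorem existsUnique_zero_of_mul_sub_le {f : ℝ → ℝ} {m : ℝ} (hm : 0 < m) (hf : Continuous f)
    (h : ∀ x y, x ≤ y → m * (y - x) ≤ f x - f y) : ∃! e, f e = 0 := by
  set r := |f 0| / m with hr
  have hr0 : 0 ≤ r := by positivity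
  have hmr : m * r = |f 0| := by rw [hr]; field_simp
  have hpos := h 0 r hr0
  have hneg := h (-r) 0 (by linarith)
  obtain ⟨e, -, he⟩ := intermediate_value_Icc' (by linarith : -r ≤ r) hf.continuousOn
    (show (0 : ℝ) ∈ Set.Icc (f r) (f (-r)) from
      ⟨by linarith [le_abs_self (f 0)], by linarith [neg_abs_le (f 0)]⟩)
  refine ⟨e, he, fun y hy => ?_⟩
  rcases le_total e y with hle | hle
  · have := h e y hle
    nlinarith
  · have := h y e hle
    nlinarith

/-- The score whose expectation vanishes exactly at the `α`-expectile. -/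
def expectileScore (α x e : ℝ) : ℝ := α * max (x - e) 0 - (1 - α) * max (e - x) 0

theorem expectileScore_sub_mem_Icc {α : ℝ} (hα : α ∈ Set.Ioo (0 : ℝ) 1) (x : ℝ) {a b : ℝ}
    (hab : a ≤ b) :
    expectileScore α x a - expectileScore α x b ∈ Set.Icc (min α (1 - α) * (b - a)) (b - a) := by
  obtain ⟨h0, h1⟩ := hα
  have hl := min_le_left α (1 - α)
  have hr := min_le_right α (1 - α)
  unfold expectileScore
  generalize min α (1 - α) = m at *
  rcases le_total x a with hxa | hxa
  · rw [max_eq_right (by linarith : x - a ≤ 0), max_eq_left (by linarith : 0 ≤ a - x),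
      max_eq_right (by linarith : x - b ≤ 0), max_eq_left (by linarith : 0 ≤ b - x)]
    constructor <;> nlinarith
  · rcases le_total x b with hxb | hxb
    · rw [max_eq_left (by linarith : 0 ≤ x - a), max_eq_right (by linarith : a - x ≤ 0),
        max_eq_right (by linarith : x - b ≤ 0), max_eq_left (by linarith : 0 ≤ b - x)]
      constructor <;> nlinarith
    · rw [max_eq_left (by linarith : 0 ≤ x - a), max_eq_right (by linarith : a - x ≤ 0),
        max_eq_left (by linarith : 0 ≤ x - b), max_eq_right (by linarith : b - x ≤ 0)]
      constructor <;> nlinarith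

section

variable {Ω : Type*} [MeasurableSpace Ω] {P : Measure Ω} {X : Ω → ℝ}

theorem integrable_expectileScore [IsFiniteMeasure P] (hX : Integrable X P) (α e : ℝ) :
    Integrable (fun ω => expectileScore α (X ω) e) P :=
  ((hX.sub (integrable_const e)).pos_part.const_mul α).sub
    (((integrable_const e).sub hX).pos_part.const_mul (1 - α))

theorem expectileEq_iff_integral_expectileScore_eq_zero [IsFiniteMeasure P]
    (hX : Integrable X P) (α e : ℝ) :
    ExpectileEq P α X e ↔ ∫ ω, expectileScore α (X ω) e ∂P = 0 := by
  have hp : Integrable (fun ω => α * max (X ω - e) 0) P :=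
    (hX.sub (integrable_const e)).pos_part.const_mul α
  have hn : Integrable (fun ω => (1 - α) * max (e - X ω) 0) P :=
    ((integrable_const e).sub hX).pos_part.const_mul (1 - α)
  unfold ExpectileEq expectileScore
  rw [integral_sub hp hn, integral_const_mul, integral_const_mul, sub_eq_zero]

theorem integral_expectileScore_sub_mem_Icc [IsProbabilityMeasure P] (hX : Integrable X P)
    {α : ℝ} (hα : α ∈ Set.Ioo (0 : ℝ) 1) {a b : ℝ} (hab : a ≤ b) :
    ∫ ω, expectileScore α (X ω) a ∂P - ∫ ω, expectileScore α (X ω) b ∂P ∈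
      Set.Icc (min α (1 - α) * (b - a)) (b - a) := by
  have ha := integrable_expectileScore hX α a
  have hb := integrable_expectileScore hX α b
  rw [← integral_sub ha hb]
  constructor
  · simpa using integral_mono (integrable_const _) (ha.sub hb)
      fun ω => (expectileScore_sub_mem_Icc hα (X ω) hab).1
  · simpa using integral_mono (ha.sub hb) (integrable_const _)
      fun ω => (expectileScore_sub_mem_Icc hα (X ω) hab).2

end

/-- For every level `α ∈ (0,1)` and every integrable random variable `X`,
there exists exactly one real number `e` satisfying the α-expectile equation
`α·E[max(X−e,0)] = (1−α)·E[max(e−X,0)]`. -/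
theorem expectile_exists_unique
    {Ω : Type*} [MeasurableSpace Ω] (P : Measure Ω) [IsProbabilityMeasure P]
    (X : Ω → ℝ) (hX : Integrable X P)
    (α : ℝ) (hα : α ∈ Set.Ioo (0:ℝ) 1) :
    ∃! e : ℝ, ExpectileEq P α X e := by
  have hm : 0 < min α (1 - α) := lt_min hα.1 (sub_pos.2 hα.2)
  have hcont : Continuous fun e => ∫ ω, expectileScore α (X ω) e ∂P := by
    refine (LipschitzWith.of_dist_le_mul (K := 1) fun a b => ?_).continuous
    rw [NNReal.coe_one, one_mul, Real.dist_eq, Real.dist_eq]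
    rcases le_total a b with hab | hab
    · have h := integral_expectileScore_sub_mem_Icc hX hα hab
      rw [abs_of_nonneg (le_trans (mul_nonneg hm.le (sub_nonneg.2 hab)) h.1), abs_sub_comm,
        abs_of_nonneg (sub_nonneg.2 hab)]
      exact h.2
    · have h := integral_expectileScore_sub_mem_Icc hX hα hab
      rw [abs_sub_comm, abs_of_nonneg (le_trans (mul_nonneg hm.le (sub_nonneg.2 hab)) h.1),
        abs_of_nonneg (sub_nonneg.2 hab)]
      exact h.2
  simp only [expectileEq_iff_integral_expectileScore_eq_zero hX]
  exact existsUnique_zero_of_mul_sub_le hm hcont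
    fun a b hab => (integral_expectileScore_sub_mem_Icc hX hα hab).1
end

section
/- Let α ∈ (0,1) and let X and Y be integrable random variables on the same probability space with X ≤ Y almost surely. Then the unique solutions e_α(X) and e_α(Y) of the respective α-expectile equations satisfy e_α(X) ≤ e_α(Y) (monotonicity of the expectile). -/
open MeasureTheory

/-- The asymmetric identification function `t ↦ α * t⁺ - (1 - α) * t⁻` of the expectile increases
with slope at least `min α (1 - α)`. -/
theorem min_mul_sub_le_asymm_sub (α : ℝ) {u v : ℝ} (huv : u ≤ v) :
    min α (1 - α) * (v - u) ≤
      (α * max v 0 - (1 - α) * max (-v) 0) - (α * max u 0 - (1 - α) * max (-u) 0) := by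
  have h₁ := min_le_left α (1 - α)
  have h₂ := min_le_right α (1 - α)
  rcases le_total 0 u with hu | hu <;> rcases le_total 0 v with hv | hv <;>
    simp only [max_eq_left, max_eq_right, neg_nonneg, neg_nonpos, hu, hv] <;> nlinarith

/-- The expectile equation says that the identification function has zero expectation. -/
theorem ExpectileEq.integral_eq_zero {Ω : Type*} [MeasurableSpace Ω] {P : Measure Ω}
    [IsFiniteMeasure P] {α : ℝ} {X : Ω → ℝ} {e : ℝ} (h : ExpectileEq P α X e)
    (hX : Integrable X P) :
    ∫ ω, (α * max (X ω - e) 0 - (1 - α) * max (-(X ω - e)) 0) ∂P = 0 := by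
  have hi : Integrable (fun ω => X ω - e) P := hX.sub (integrable_const e)
  rw [integral_sub (hi.pos_part.const_mul α) (hi.neg_part.const_mul (1 - α)),
    integral_const_mul, integral_const_mul, sub_eq_zero]
  simpa only [ExpectileEq, neg_sub] using h

/-- Let `α ∈ (0,1)` and let `X` and `Y` be integrable random variables
on the same probability space with `X ≤ Y` almost surely. Then the solutions `e_α(X)` and
`e_α(Y)` of the respective α-expectile equations satisfy `e_α(X) ≤ e_α(Y)`
(monotonicity of the expectile). -/
theorem expectile_monotone
    {Ω : Type*} [MeasurableSpace Ω] (P : Measure Ω) [IsProbabilityMeasure P]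
    (X Y : Ω → ℝ) (hX : Integrable X P) (hY : Integrable Y P)
    (hXY : ∀ᵐ ω ∂P, X ω ≤ Y ω)
    (α : ℝ) (hα : α ∈ Set.Ioo (0:ℝ) 1)
    (eX eY : ℝ) (heX : ExpectileEq P α X eX) (heY : ExpectileEq P α Y eY) :
    eX ≤ eY := by
  by_contra! hlt
  have hiX : Integrable (fun ω => X ω - eX) P := hX.sub (integrable_const eX)
  have hiY : Integrable (fun ω => Y ω - eY) P := hY.sub (integrable_const eY)
  have hc : 0 < min α (1 - α) := lt_min hα.1 (sub_pos.2 hα.2)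
  have hφX := (hiX.pos_part.const_mul α).sub (hiX.neg_part.const_mul (1 - α))
  have hφY := (hiY.pos_part.const_mul α).sub (hiY.neg_part.const_mul (1 - α))
  have hle := integral_mono_ae (integrable_const (min α (1 - α) * (eX - eY)))
    (hφY.sub hφX) (by
      filter_upwards [hXY] with ω hω
      refine le_trans ?_ (min_mul_sub_le_asymm_sub α (by linarith : X ω - eX ≤ Y ω - eY))
      exact mul_le_mul_of_nonneg_left (by linarith) hc.le)
  rw [integral_sub' hφY hφX] at hle
  simp only [Pi.sub_apply, heX.integral_eq_zero hX, heY.integral_eq_zero hY, integral_const,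
    probReal_univ, one_smul, sub_zero] at hle
  exact absurd hle (not_le.2 (mul_pos hc (sub_pos.2 hlt)))
end

section
/- Let α ∈ [1/2, 1) with β = (2α−1)/(1−α), and let Y be a normally distributed random variable with mean μ ∈ ℝ and standard deviation σ > 0. Then for every y ∈ ℝ, h_{Y,α}(y) = μ + β·(1 − Φ((y−μ)/σ))·(μ − y) + β·σ·φ((y−μ)/σ), where φ and Φ denote the probability density function and the cumulative distribution function of the standard normal distribution. -/
open MeasureTheory

open ProbabilityTheory

lemma gaussianPDFReal_zero_one (x : ℝ) :
    gaussianPDFReal 0 1 x = (Real.sqrt (2 * Real.pi))⁻¹ * Real.exp (-x ^ 2 / 2) := by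
  simp [gaussianPDFReal]

lemma hasDerivAt_neg_gaussianPDFReal_zero_one (x : ℝ) :
    HasDerivAt (fun t ↦ -gaussianPDFReal 0 1 t) (x * gaussianPDFReal 0 1 x) x := by
  simp only [gaussianPDFReal_zero_one]
  have hd : HasDerivAt (fun t : ℝ ↦ -t ^ 2 / 2) (-x) x := by
    convert! ((hasDerivAt_pow 2 x).neg.div_const 2) using 1
    norm_num
    ring
  convert! (hd.exp.const_mul (Real.sqrt (2 * Real.pi))⁻¹).neg using 1
  ring

lemma integrable_mul_gaussianPDFReal_zero_one :
    Integrable (fun x ↦ x * gaussianPDFReal 0 1 x) := by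
  have hi := (integrable_mul_exp_neg_mul_sq (b := 1 / 2) (by norm_num)).const_mul
    (Real.sqrt (2 * Real.pi))⁻¹
  refine hi.congr (ae_of_all _ fun x ↦ ?_)
  simp only [gaussianPDFReal_zero_one]
  rw [show -(1 / 2) * x ^ 2 = -x ^ 2 / 2 by ring]
  ring

lemma tendsto_gaussianPDFReal_zero_one_atTop :
    Filter.Tendsto (gaussianPDFReal 0 1) Filter.atTop (nhds 0) := by
  have hsq : Filter.Tendsto (fun x : ℝ ↦ -x ^ 2 / 2) Filter.atTop Filter.atBot := by
    have := (Filter.tendsto_pow_atTop (α := ℝ) two_ne_zero).atTop_div_const (two_pos)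
    simpa only [neg_div, Function.comp_def] using Filter.tendsto_neg_atTop_atBot.comp this
  have := (Real.tendsto_exp_atBot.comp hsq).const_mul (Real.sqrt (2 * Real.pi))⁻¹
  rw [mul_zero] at this
  exact this.congr fun x ↦ (gaussianPDFReal_zero_one x).symm

lemma setIntegral_Ioi_mul_gaussianPDFReal_zero_one (z : ℝ) :
    ∫ x in Set.Ioi z, x * gaussianPDFReal 0 1 x = gaussianPDFReal 0 1 z := by
  rw [integral_Ioi_of_hasDerivAt_of_tendsto'
    (fun x _ ↦ hasDerivAt_neg_gaussianPDFReal_zero_one x)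
    integrable_mul_gaussianPDFReal_zero_one.integrableOn
    tendsto_gaussianPDFReal_zero_one_atTop.neg]
  ring

lemma setIntegral_Ioi_gaussianPDFReal_zero_one (z : ℝ) :
    ∫ x in Set.Ioi z, gaussianPDFReal 0 1 x = 1 - ∫ x in Set.Iic z, gaussianPDFReal 0 1 x := by
  have hadd := integral_add_compl (measurableSet_Iic (a := z)) (integrable_gaussianPDFReal 0 1)
  rw [Set.compl_Iic, integral_gaussianPDFReal_eq_one 0 one_ne_zero] at hadd
  linarith

/-- The expected excess of a standard normal variable over a threshold `z`. -/
lemma integral_max_sub_zero_gaussianReal_zero_one (z : ℝ) :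
    ∫ x, max (x - z) 0 ∂gaussianReal 0 1 =
      gaussianPDFReal 0 1 z - z * (1 - ∫ x in Set.Iic z, gaussianPDFReal 0 1 x) := by
  rw [integral_gaussianReal_eq_integral_smul one_ne_zero]
  have hind : (fun x ↦ gaussianPDFReal 0 1 x • max (x - z) 0) = (Set.Ioi z).indicator
      (fun x ↦ x * gaussianPDFReal 0 1 x - z * gaussianPDFReal 0 1 x) := by
    ext x
    by_cases hx : z < x
    · rw [Set.indicator_of_mem (Set.mem_Ioi.2 hx), max_eq_left (by linarith), smul_eq_mul]
      ring
    · rw [Set.indicator_of_notMem (by simpa using hx), max_eq_right (by linarith), smul_zero]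
  rw [hind, integral_indicator measurableSet_Ioi,
    integral_sub integrable_mul_gaussianPDFReal_zero_one.integrableOn
      ((integrable_gaussianPDFReal 0 1).const_mul z).integrableOn,
    integral_const_mul, setIntegral_Ioi_mul_gaussianPDFReal_zero_one,
    setIntegral_Ioi_gaussianPDFReal_zero_one]

lemma gaussianReal_eq_map_zero_one (μ σ : ℝ) :
    gaussianReal μ ⟨σ ^ 2, sq_nonneg σ⟩ = (gaussianReal 0 1).map (fun x ↦ σ * x + μ) := by
  have hcomp : (fun x ↦ σ * x + μ) = (fun x ↦ x + μ) ∘ (fun x ↦ σ * x) := rfl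
  rw [hcomp, ← Measure.map_map (by fun_prop) (by fun_prop), gaussianReal_map_const_mul,
    gaussianReal_map_add_const, mul_zero, zero_add, mul_one]
  rfl

/-- Let `α ∈ [1/2, 1)` with `β = (2α−1)/(1−α)`, and let `Y` be a
normally distributed random variable with mean `μ` and standard deviation `σ > 0`.
Then for every `y ∈ ℝ`,
`h_{Y,α}(y) = μ + β·(1 − Φ((y−μ)/σ))·(μ − y) + β·σ·φ((y−μ)/σ)`,
where `φ` and `Φ` are the standard normal pdf and cdf. -/
theorem expectile_objective_gaussian
    {Ω : Type*} [MeasurableSpace Ω] (P : Measure Ω) [IsProbabilityMeasure P]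
    (Y : Ω → ℝ) (hYm : Measurable Y)
    (μ σ : ℝ) (hσ : 0 < σ)
    (hY : Measure.map Y P = ProbabilityTheory.gaussianReal μ ⟨σ^2, sq_nonneg σ⟩)
    (α β : ℝ) (hα : α ∈ Set.Ico (1/2 : ℝ) 1) (hβ : β = (2*α - 1)/(1 - α))
    (φ Φ : ℝ → ℝ)
    (hφ : ∀ z : ℝ, φ z = (Real.sqrt (2 * Real.pi))⁻¹ * Real.exp (-z^2 / 2))
    (hΦ : ∀ z : ℝ, Φ z = ∫ t in Set.Iic z, φ t)
    (h : ℝ → ℝ) (hh : ∀ y, h y = ∫ ω, max ((1 + β) * Y ω - β * y) (Y ω) ∂P) :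
    ∀ y : ℝ,
      h y = μ + β * (1 - Φ ((y - μ) / σ)) * (μ - y) + β * σ * φ ((y - μ) / σ) := by
  intro y
  have hφ' : φ = gaussianPDFReal 0 1 := funext fun z ↦ by rw [hφ, gaussianPDFReal_zero_one]
  have hβ0 : 0 ≤ β := by
    rw [hβ]
    exact div_nonneg (by linarith [hα.1]) (by linarith [hα.2])
  have hid : Integrable (fun x : ℝ ↦ x) (gaussianReal 0 1) :=
    (memLp_id_gaussianReal 1).integrable le_rfl
  set z := (y - μ) / σ with hz
  have hy : y = σ * z + μ := by rw [hz]; field_simp; ring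
  have hmax : ∀ x : ℝ, max ((1 + β) * (σ * x + μ) - β * y) (σ * x + μ)
      = σ * x + μ + β * σ * max (x - z) 0 := by
    intro x
    rw [mul_max_of_nonneg _ _ (mul_nonneg hβ0 hσ.le), ← max_add_add_left, hy]
    ring_nf
  rw [hh, ← integral_map (f := fun x ↦ max ((1 + β) * x - β * y) x) hYm.aemeasurable
      (by fun_prop), hY, gaussianReal_eq_map_zero_one,
    integral_map (by fun_prop) (by fun_prop)]
  simp only [hmax]
  have hlin : Integrable (fun x ↦ σ * x + μ) (gaussianReal 0 1) :=
    (hid.const_mul σ).add (integrable_const μ)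
  have hexc : Integrable (fun x ↦ max (x - z) 0) (gaussianReal 0 1) :=
    (hid.sub (integrable_const z)).pos_part
  rw [integral_add hlin (hexc.const_mul (β * σ)),
    integral_add (hid.const_mul σ) (integrable_const μ), integral_const_mul, integral_const_mul,
    integral_id_gaussianReal, integral_max_sub_zero_gaussianReal_zero_one, hΦ, hφ', hy]
  simp
  ring
end

section
/- Let X be an integrable real random variable whose cumulative distribution function F is continuous, and let λ ∈ (0,1). Then P(X ≤ q(λ)) = λ > 0 and E[−X | X ≤ q(λ)] = (1/λ)·∫_0^λ VaR_u(X) du; that is, the Conditional Value-at-Risk E[−X | X ≤ −VaR_λ(X)] equals the average of the Value-at-Risk over levels u ∈ (0, λ). -/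
open MeasureTheory

open ProbabilityTheory Filter Topology

/-- Galois connection between the lower quantile function and the distribution function. -/
lemma sInf_le_cdf_le_iff (ν : Measure ℝ) {u : ℝ} (hu : u ∈ Set.Ioo (0 : ℝ) 1) (x : ℝ) :
    sInf {y : ℝ | u ≤ cdf ν y} ≤ x ↔ u ≤ cdf ν x := by
  obtain ⟨b, hb⟩ := ((tendsto_cdf_atTop ν).eventually_const_le hu.2).exists
  obtain ⟨a, ha⟩ := ((tendsto_cdf_atBot ν).eventually_lt_const hu.1).exists
  have hbdd : BddBelow {y : ℝ | u ≤ cdf ν y} := by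
    refine ⟨a, fun y hy => le_of_not_gt fun hya => ?_⟩
    exact absurd (hy.trans (monotone_cdf ν hya.le)) (not_le.2 ha)
  refine ⟨fun h => ?_, fun h => csInf_le hbdd h⟩
  have hlim : Tendsto (cdf ν) (𝓝[>] x) (𝓝 (cdf ν x)) :=
    ((cdf ν).right_continuous x).mono Set.Ioi_subset_Ici_self
  refine ge_of_tendsto hlim ?_
  filter_upwards [self_mem_nhdsWithin] with y hy
  obtain ⟨z, hz, hzy⟩ := exists_lt_of_csInf_lt ⟨b, hb⟩ (h.trans_lt hy)
  exact hz.trans (monotone_cdf ν hzy.le)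

lemma monotoneOn_sInf_le_cdf (ν : Measure ℝ) :
    MonotoneOn (fun u : ℝ => sInf {y : ℝ | u ≤ cdf ν y}) (Set.Ioo 0 1) := fun _ hu _ hv huv =>
  (sInf_le_cdf_le_iff ν hu _).2 (huv.trans ((sInf_le_cdf_le_iff ν hv _).1 le_rfl))

lemma aemeasurable_sInf_le_cdf (ν : Measure ℝ) :
    AEMeasurable (fun u : ℝ => sInf {y : ℝ | u ≤ cdf ν y}) (volume.restrict (Set.Ioo 0 1)) :=
  aemeasurable_restrict_of_monotoneOn measurableSet_Ioo (monotoneOn_sInf_le_cdf ν)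

/-- The lower quantile function pushes the uniform law on `(0, 1)` forward to `ν`. -/
lemma map_sInf_le_cdf (ν : Measure ℝ) [IsProbabilityMeasure ν] :
    (volume.restrict (Set.Ioo (0 : ℝ) 1)).map (fun u => sInf {y : ℝ | u ≤ cdf ν y}) = ν := by
  refine Measure.ext_of_Iic _ _ fun x => ?_
  rw [Measure.map_apply_of_aemeasurable (aemeasurable_sInf_le_cdf ν) measurableSet_Iic,
    Measure.restrict_apply' measurableSet_Ioo]
  have hset : (fun u => sInf {y : ℝ | u ≤ cdf ν y}) ⁻¹' Set.Iic x ∩ Set.Ioo 0 1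
      = Set.Iic (cdf ν x) ∩ Set.Ioo 0 1 := by
    ext u
    exact and_congr_left fun hu => sInf_le_cdf_le_iff ν hu x
  have hae : (Set.Iic (cdf ν x) ∩ Set.Ioo 0 1 : Set ℝ) =ᵐ[volume]
      (Set.Iic (cdf ν x) ∩ Set.Ioc 0 1 : Set ℝ) :=
    (ae_eq_refl _).inter Ioo_ae_eq_Ioc
  rw [hset, measure_congr hae, Set.inter_comm, Set.Ioc_inter_Iic,
    min_eq_right (cdf_le_one ν x), Real.volume_Ioc, sub_zero, ofReal_cdf]

lemma cdf_sInf_le_cdf {ν : Measure ℝ} (hν : Continuous (cdf ν)) {u : ℝ}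
    (hu : u ∈ Set.Ioo (0 : ℝ) 1) : cdf ν (sInf {y : ℝ | u ≤ cdf ν y}) = u := by
  refine le_antisymm ?_ ((sInf_le_cdf_le_iff ν hu _).1 le_rfl)
  refine le_of_tendsto (hν.continuousWithinAt
    (s := Set.Iio (sInf {y : ℝ | u ≤ cdf ν y}))).tendsto ?_
  filter_upwards [self_mem_nhdsWithin] with y hy
  exact (not_le.1 fun h => not_le.2 hy ((sInf_le_cdf_le_iff ν hu y).2 h)).le

/-- Let `X` be an integrable real random variable whose cumulative
distribution function `F` is continuous, and let `λ ∈ (0,1)`. Then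
`P(X ≤ q(λ)) = λ > 0` and `E[−X | X ≤ q(λ)] = (1/λ)·∫_0^λ VaR_u(X) du`, where
`q(u) = inf {x : u ≤ F x}`, `VaR_u(X) = −q(u)`, and `E[Z | A] = E[Z·1_A]/P(A)`. -/
theorem cvar_as_average_of_var
    {Ω : Type*} [MeasurableSpace Ω] (P : Measure Ω) [IsProbabilityMeasure P]
    (X : Ω → ℝ) (hX : Measurable X) (hXi : Integrable X P)
    (F : ℝ → ℝ) (hF : ∀ x : ℝ, F x = (P {ω | X ω ≤ x}).toReal)
    (hFcont : Continuous F)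
    (l : ℝ) (hl : l ∈ Set.Ioo (0:ℝ) 1) :
    (P {ω | X ω ≤ sInf {x : ℝ | l ≤ F x}}).toReal = l ∧ 0 < l ∧
      (∫ ω in {ω | X ω ≤ sInf {x : ℝ | l ≤ F x}}, (-X ω) ∂P) /
          (P {ω | X ω ≤ sInf {x : ℝ | l ≤ F x}}).toReal
        = (1 / l) * ∫ u in (0:ℝ)..l, -sInf {x : ℝ | u ≤ F x} := by
  have : IsProbabilityMeasure (P.map X) := Measure.isProbabilityMeasure_map hX.aemeasurable
  obtain rfl : F = cdf (P.map X) := by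
    ext x
    rw [hF, cdf_eq_real, measureReal_def, Measure.map_apply hX measurableSet_Iic]
    rfl
  set ν := P.map X
  have hFl := cdf_sInf_le_cdf hFcont hl
  set c := sInf {x : ℝ | l ≤ cdf ν x}
  have hPl : (P {ω | X ω ≤ c}).toReal = l := by rw [← hF, hFl]
  refine ⟨hPl, hl.1, ?_⟩
  have hset : (fun u => sInf {y : ℝ | u ≤ cdf ν y}) ⁻¹' Set.Iic c ∩ Set.Ioo 0 1
      = Set.Ioc 0 l := by
    ext u
    constructor
    · rintro ⟨huc, hu⟩
      exact ⟨hu.1, hFl ▸ (sInf_le_cdf_le_iff ν hu c).1 huc⟩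
    · intro hu
      have hu' : u ∈ Set.Ioo (0 : ℝ) 1 := ⟨hu.1, hu.2.trans_lt hl.2⟩
      exact ⟨(sInf_le_cdf_le_iff ν hu' c).2 (hFl.symm ▸ hu.2), hu'⟩
  have hq := aemeasurable_sInf_le_cdf ν
  have key : ∫ ω in {ω | X ω ≤ c}, (-X ω) ∂P
      = ∫ u in (0:ℝ)..l, -sInf {x : ℝ | u ≤ cdf ν x} := by
    calc ∫ ω in {ω | X ω ≤ c}, (-X ω) ∂P
        = ∫ x in Set.Iic c, -x ∂ν :=
          (setIntegral_map measurableSet_Iic continuous_neg.aestronglyMeasurable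
            hX.aemeasurable).symm
      _ = ∫ x in Set.Iic c, -x ∂((volume.restrict (Set.Ioo (0 : ℝ) 1)).map
            (fun u => sInf {y : ℝ | u ≤ cdf ν y})) := by rw [map_sInf_le_cdf]
      _ = ∫ u in (0:ℝ)..l, -sInf {x : ℝ | u ≤ cdf ν x} := by
          rw [setIntegral_map measurableSet_Iic continuous_neg.aestronglyMeasurable hq,
            Measure.restrict_restrict₀' measurableSet_Ioo.nullMeasurableSet, hset,
            intervalIntegral.integral_of_le hl.1.le]
  rw [hPl, key, div_eq_inv_mul, one_div]
end
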